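/- For every integer n ≥ 1: (i) ∑_{j=1}^{n} H_{j,2}^2/(j+1) = ∑_{j=1}^{n} H_{j,2}^2/j − 2 ∑_{j=1}^{n} H_{j,2}/j^3 + H_{n,5} + H_{n,2}^2/(n+1); and (ii) for every integer m ≥ 2, ∑_{j=1}^{n} H_{j,2}^2/(j+m) = ∑_{j=1}^{n} H_{j,2}^2/(j+m−1) − (2/(m−1)^2) ∑_{j=1}^{n} H_{j,2}/(j+m−1) − H_{n,2}^2/(m−1) + 2H_{n,1}H_{n,2}/(m−1)^2 + H_{n,2}/(m−1)^3 + H_{n,3}/(m−1)^2 − (2/(m−1)^2) ∑_{j=1}^{n} H_{j,1}/j^2 − H_{m−1,1}/(m−1)^4 + H_{n,2}^2/(n+m) + (1/(m−1)^4) ∑_{j=n+1}^{n+m−1} 1/j. -/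

import Mathlib

open Finset Filter Real Topology

/-- Generalized harmonic number `H (n, m) = ∑_{i=1}^{n} 1/i^m` as a real number. -/
noncomputable def H (n m : ℕ) : ℝ := ∑ i ∈ Finset.Icc 1 n, (1 : ℝ) / (i : ℝ) ^ m

/-- Apéry's constant `ζ(3) = ∑_{k=1}^{∞} 1/k³`. -/
noncomputable def zeta3 : ℝ := ∑' k : ℕ, 1 / ((k : ℝ) + 1) ^ 3

lemma H_zero (m : ℕ) : H 0 m = 0 := by simp [H]

lemma H_succ (n m : ℕ) : H (n + 1) m = H n m + 1 / ((n : ℝ) + 1) ^ m := by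
  unfold H
  rw [Finset.sum_Icc_succ_top (by omega)]
  push_cast
  rfl

lemma tail_sum (n k : ℕ) :
    ∑ j ∈ Finset.Icc (n + 1) (n + k), (1 : ℝ) / (j : ℝ) = H (n + k) 1 - H n 1 := by
  induction k with
  | zero => simp
  | succ k ih =>
    rw [← add_assoc, Finset.sum_Icc_succ_top (by omega), ih, H_succ]
    push_cast
    ring

lemma part1 (n : ℕ) :
      ∑ j ∈ Finset.Icc 1 n, (H j 2) ^ 2 / ((j : ℝ) + 1) =
        (∑ j ∈ Finset.Icc 1 n, (H j 2) ^ 2 / (j : ℝ))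
          - 2 * (∑ j ∈ Finset.Icc 1 n, H j 2 / (j : ℝ) ^ 3)
          + H n 5 + (H n 2) ^ 2 / ((n : ℝ) + 1) := by
  induction n with
  | zero => simp [H_zero]
  | succ n ih =>
    simp only [Finset.sum_Icc_succ_top (show 1 ≤ n + 1 by omega)]
    rw [ih]
    simp only [H_succ]
    push_cast
    have h1 : (n : ℝ) + 1 ≠ 0 := by positivity
    have h2 : (n : ℝ) + 1 + 1 ≠ 0 := by positivity
    field_simp
    ring

lemma part2 (k : ℕ) (hk : 1 ≤ k) (n : ℕ) :
      ∑ j ∈ Finset.Icc 1 n, (H j 2) ^ 2 / ((j : ℝ) + k + 1) =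
        (∑ j ∈ Finset.Icc 1 n, (H j 2) ^ 2 / ((j : ℝ) + k))
          - (2 / (k : ℝ) ^ 2) * ∑ j ∈ Finset.Icc 1 n, H j 2 / ((j : ℝ) + k)
          - (H n 2) ^ 2 / (k : ℝ)
          + 2 * H n 1 * H n 2 / (k : ℝ) ^ 2
          + H n 2 / (k : ℝ) ^ 3
          + H n 3 / (k : ℝ) ^ 2
          - (2 / (k : ℝ) ^ 2) * ∑ j ∈ Finset.Icc 1 n, H j 1 / (j : ℝ) ^ 2
          - H k 1 / (k : ℝ) ^ 4
          + (H n 2) ^ 2 / ((n : ℝ) + k + 1)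
          + (1 / (k : ℝ) ^ 4) * (H (n + k) 1 - H n 1) := by
  induction n with
  | zero => simp [H_zero]; ring
  | succ n ih =>
    simp only [Finset.sum_Icc_succ_top (show 1 ≤ n + 1 by omega)]
    rw [ih, show n + 1 + k = (n + k) + 1 by ring]
    simp only [H_succ]
    push_cast
    have hk' : (0 : ℝ) < k := by exact_mod_cast hk
    generalize (k : ℝ) = x at *
    have hn : (0 : ℝ) ≤ n := n.cast_nonneg
    generalize (n : ℝ) = y at *
    generalize H n 2 = a at *
    generalize H n 1 = b at *
    generalize H n 3 = c at *
    generalize H k 1 = d at *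
    generalize H (n + k) 1 = e at *
    clear ih
    rw [show y + 1 + x = y + x + 1 by ring]
    have h1 : y + 1 ≠ 0 := by positivity
    have h2 : y + x + 1 ≠ 0 := by positivity
    have h3 : y + x + 1 + 1 ≠ 0 := by positivity
    have h4 : x ≠ 0 := hk'.ne'
    field_simp
    ring

theorem sum_H2_sq_div_shift :
    (∀ n : ℕ, 1 ≤ n →
      ∑ j ∈ Finset.Icc 1 n, (H j 2) ^ 2 / ((j : ℝ) + 1) =
        (∑ j ∈ Finset.Icc 1 n, (H j 2) ^ 2 / (j : ℝ))
          - 2 * (∑ j ∈ Finset.Icc 1 n, H j 2 / (j : ℝ) ^ 3)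
          + H n 5 + (H n 2) ^ 2 / ((n : ℝ) + 1)) ∧
    (∀ n : ℕ, 1 ≤ n → ∀ m : ℕ, 2 ≤ m →
      ∑ j ∈ Finset.Icc 1 n, (H j 2) ^ 2 / ((j : ℝ) + m) =
        (∑ j ∈ Finset.Icc 1 n, (H j 2) ^ 2 / ((j : ℝ) + m - 1))
          - (2 / ((m : ℝ) - 1) ^ 2) * ∑ j ∈ Finset.Icc 1 n, H j 2 / ((j : ℝ) + m - 1)
          - (H n 2) ^ 2 / ((m : ℝ) - 1)
          + 2 * H n 1 * H n 2 / ((m : ℝ) - 1) ^ 2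
          + H n 2 / ((m : ℝ) - 1) ^ 3
          + H n 3 / ((m : ℝ) - 1) ^ 2
          - (2 / ((m : ℝ) - 1) ^ 2) * ∑ j ∈ Finset.Icc 1 n, H j 1 / (j : ℝ) ^ 2
          - H (m - 1) 1 / ((m : ℝ) - 1) ^ 4
          + (H n 2) ^ 2 / ((n : ℝ) + m)
          + (1 / ((m : ℝ) - 1) ^ 4) *
              ∑ j ∈ Finset.Icc (n + 1) (n + m - 1), (1 : ℝ) / (j : ℝ)) := by
  refine ⟨fun n _ => part1 n, fun n _ m hm => ?_⟩
  obtain ⟨k, rfl⟩ : ∃ k, m = k + 1 := ⟨m - 1, by omega⟩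
  have h := part2 k (by omega) n
  rw [← tail_sum] at h
  have e1 : ∀ z : ℝ, z + ((k : ℝ) + 1) - 1 = z + k := fun z => by ring
  have e2 : n + (k + 1) - 1 = n + k := by omega
  simp only [Nat.cast_add, Nat.cast_one, e1, e2, add_sub_cancel_right, Nat.add_sub_cancel,
    ← add_assoc] at h ⊢
  simp only [add_assoc, add_sub_cancel_right] at h ⊢
  simpa [← add_assoc] using h
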